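/- arXiv:1810.02677 — 2 statements merged into one kernel-verified Lean document; each statement's English description precedes it below -/
import Mathlib

section
/- Fix α ∈ {1,...,K} and i ∈ I_α. Suppose vectors x̄^(α) ∈ R^d and z̄^(α,β) ∈ R^d (β ≠ α) satisfy the centroid optimality condition n_α (x̄^(α) − a^(α)) + γ Σ_{β≠α} w^(α,β) z̄^(α,β) = 0. Define p_k^(α) = Σ_{β≠α} [w_k^(β) − w^(α,β)/n_α] z̄^(α,β) for k ∈ I_α, set z_ij* = z̄^(α,β) for j ∈ I_β with β ≠ α, and z_ij* = (1/(n_α w_ij)) [ (1/γ)(a_i − a_j) − (p_i^(α) − p_j^(α)) ] for j ∈ I_α, j ≠ i (with z_ii* = 0). Then x̄^(α) − a_i + γ Σ_{j=1, j≠i}^n w_ij z_ij* = 0. -/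
open Finset

/-- A sum over a finite type splits along a finite family of pairwise disjoint covering finsets. -/
theorem sum_univ_eq_sum_sum_of_partition {ι κ M : Type*} [Fintype ι] [Fintype κ]
    [AddCommMonoid M] (I : κ → Finset ι)
    (hdisj : ∀ α β, α ≠ β → Disjoint (I α) (I β)) (hcover : ∀ i, ∃ α, i ∈ I α) (f : ι → M) :
    ∑ j, f j = ∑ β, ∑ j ∈ I β, f j := by
  classical
  rw [← Finset.sum_biUnion fun α _ β _ h => hdisj α β h]
  congr 1
  ext j
  simpa using hcover j

/-- In the proof of Theorem 3 of Sun–Toh–Yuan: fix `α` and `i ∈ I_α`. If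
`(x̄^(α), z̄^(α,β))` satisfy the centroid optimality condition
`n_α (x̄^(α) − a^(α)) + γ Σ_{β≠α} w^(α,β) z̄^(α,β) = 0`, and `z*` is defined by
`z*_ij = z̄^(α,β)` for `j ∈ I_β` (β ≠ α), `z*_ij = (1/(n_α w_ij))[(1/γ)(a_i − a_j) −
(p_i^(α) − p_j^(α))]` for `j ∈ I_α, j ≠ i`, and `z*_ii = 0`, then
`x̄^(α) − a_i + γ Σ_{j≠i} w_ij z*_ij = 0`. -/
theorem first_order_condition_verification
    {d n K : ℕ}
    (a : Fin n → Fin d → ℝ)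
    (I : Fin K → Finset (Fin n))
    (hdisj : ∀ α β : Fin K, α ≠ β → Disjoint (I α) (I β))
    (hcover : ∀ i : Fin n, ∃ α : Fin K, i ∈ I α)
    (hne : ∀ α : Fin K, (I α).Nonempty)
    (w : Fin n → Fin n → ℝ)
    (hwsymm : ∀ i j, w i j = w j i)
    (hwnonneg : ∀ i j, 0 ≤ w i j)
    (hwpos : ∀ α : Fin K, ∀ i ∈ I α, ∀ j ∈ I α, i ≠ j → 0 < w i j)
    (cent : Fin K → Fin d → ℝ)
    (hcent : ∀ α, cent α = (((I α).card : ℝ))⁻¹ • ∑ i ∈ I α, a i)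
    (wi : Fin n → Fin K → ℝ)
    (hwi : ∀ i β, wi i β = ∑ j ∈ I β, w i j)
    (wcc : Fin K → Fin K → ℝ)
    (hwcc : ∀ α β, wcc α β = ∑ i ∈ I α, ∑ j ∈ I β, w i j)
    (γ : ℝ) (hγ : 0 < γ)
    (α : Fin K) (i : Fin n) (hi : i ∈ I α)
    (xbar : Fin d → ℝ)
    (zbar : Fin K → Fin d → ℝ)
    -- centroid optimality condition :
    (hFOC : ((I α).card : ℝ) • (xbar - cent α)
      + γ • ∑ β ∈ Finset.univ.erase α, wcc α β • zbar β = 0)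
    (pvec : Fin n → Fin d → ℝ)
    (hpvec : ∀ k, pvec k =
      ∑ β ∈ Finset.univ.erase α, (wi k β - wcc α β / ((I α).card : ℝ)) • zbar β)
    (zstar : Fin n → Fin d → ℝ)
    (hzstar_other : ∀ β : Fin K, β ≠ α → ∀ j ∈ I β, zstar j = zbar β)
    (hzstar_same : ∀ j ∈ I α, j ≠ i →
      zstar j = (((I α).card : ℝ) * w i j)⁻¹
        • (γ⁻¹ • (a i - a j) - (pvec i - pvec j)))
    (hzstar_self : zstar i = 0) :
    xbar - a i + γ • ∑ j ∈ Finset.univ.erase i, w i j • zstar j = 0 := by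
  have hn : ((I α).card : ℝ) ≠ 0 := by
    exact_mod_cast (Finset.card_pos.mpr (hne α)).ne'
  have hp : ∑ j ∈ I α, pvec j = 0 := by
    simp_rw [hpvec]
    rw [Finset.sum_comm]
    refine Finset.sum_eq_zero fun β _ => ?_
    rw [← Finset.sum_smul, Finset.sum_sub_distrib, Finset.sum_const, nsmul_eq_mul,
      mul_div_cancel₀ _ hn, hwcc]
    simp [hwi]
  have hsame : ∀ j ∈ I α, w i j • zstar j =
      ((I α).card : ℝ)⁻¹ • (γ⁻¹ • (a i - a j) - (pvec i - pvec j)) := by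
    intro j hj
    by_cases hji : j = i
    · subst hji
      simp [hzstar_self]
    · have hw : w i j ≠ 0 := (hwpos α i hi j hj (Ne.symm hji)).ne'
      rw [hzstar_same j hj hji, smul_smul]
      congr 1
      field_simp
  have hother : ∀ β ∈ Finset.univ.erase α, ∑ j ∈ I β, w i j • zstar j = wi i β • zbar β := by
    intro β hβ
    rw [hwi, Finset.sum_smul]
    exact Finset.sum_congr rfl fun j hj => by
      rw [hzstar_other β (Finset.ne_of_mem_erase hβ) j hj]
  have hsum_same : ∑ j ∈ I α, w i j • zstar j = γ⁻¹ • (a i - cent α) - pvec i := by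
    rw [Finset.sum_congr rfl hsame, ← Finset.smul_sum, Finset.sum_sub_distrib,
      ← Finset.smul_sum, Finset.sum_sub_distrib, Finset.sum_sub_distrib, hp, hcent,
      Finset.sum_const, Finset.sum_const, ← Nat.cast_smul_eq_nsmul ℝ,
      ← Nat.cast_smul_eq_nsmul ℝ]
    match_scalars <;> field_simp
  have hp_i : pvec i = ∑ β ∈ Finset.univ.erase α, wi i β • zbar β
      - ((I α).card : ℝ)⁻¹ • ∑ β ∈ Finset.univ.erase α, wcc α β • zbar β := by
    rw [hpvec, Finset.smul_sum, ← Finset.sum_sub_distrib]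
    refine Finset.sum_congr rfl fun β _ => ?_
    rw [sub_smul, smul_smul, div_eq_inv_mul]
  have hcentroid : xbar - cent α +
      (γ * ((I α).card : ℝ)⁻¹) • ∑ β ∈ Finset.univ.erase α, wcc α β • zbar β = 0 := by
    rw [← smul_zero ((I α).card : ℝ)⁻¹, ← hFOC, smul_add, inv_smul_smul₀ hn, smul_smul, mul_comm γ]
  rw [Finset.sum_erase _ (by rw [hzstar_self, smul_zero]),
    sum_univ_eq_sum_sum_of_partition I hdisj hcover,
    ← Finset.add_sum_erase _ _ (Finset.mem_univ α), hsum_same, Finset.sum_congr rfl hother, hp_i,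
    ← hcentroid]
  have hγ' := hγ.ne'
  match_scalars <;> field_simp <;> ring
end

section
/- (Panahi et al., stated as Theorem 1(i).) Take uniform weights w_ij = 1 for all i < j, let the cluster centroids a^(1),...,a^(K) be distinct, and suppose γ satisfies max_{1≤α≤K} D₂(V_α)/n_α ≤ γ ≤ d₂(C(V)) / (2n√K), where D₂(V_α) = max_{i,j∈I_α} ‖a_i − a_j‖₂ and d₂(C(V)) = min_{α≠β} ‖a^(α) − a^(β)‖₂. Then the unique minimizer X* = [x_1*,...,x_n*] of the fully uniformly weighted SON objective (with p = 2) perfectly recovers the partition: x_i* = x_j* if and only if i and j belong to the same cluster I_α. -/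
open Finset

/-- The uniformly weighted sum-of-norms objective in an inner product space, with the penalty
taken over ordered pairs. -/
noncomputable def sonObjective {ι E : Type*} [Fintype ι] [NormedAddCommGroup E]
    (γ : ℝ) (a X : ι → E) : ℝ :=
  (1 / 2) * ∑ i, ‖X i - a i‖ ^ 2 + γ / 2 * ∑ i, ∑ j, ‖X i - X j‖

section

variable {ι E : Type*} [NormedAddCommGroup E]

lemma sum_sum_eq_sum_blocks [Fintype ι] [DecidableEq ι] (S : Finset ι) (g : ι → ι → ℝ)
    (hg : ∀ i j, g i j = g j i) :
    ∑ i, ∑ j, g i j = ∑ i ∈ S, ∑ j ∈ S, g i j + 2 * ∑ j ∈ Sᶜ, ∑ i ∈ S, g i j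
      + ∑ i ∈ Sᶜ, ∑ j ∈ Sᶜ, g i j := by
  have h1 : ∀ i, ∑ j, g i j = ∑ j ∈ S, g i j + ∑ j ∈ Sᶜ, g i j := fun i =>
    (sum_add_sum_compl S _).symm
  have h2 : ∑ i ∈ Sᶜ, ∑ j ∈ S, g i j = ∑ j ∈ Sᶜ, ∑ i ∈ S, g i j :=
    sum_congr rfl fun i _ => sum_congr rfl fun j _ => hg i j
  have h3 : ∑ i ∈ S, ∑ j ∈ Sᶜ, g i j = ∑ j ∈ Sᶜ, ∑ i ∈ S, g i j := sum_comm
  rw [← sum_add_sum_compl S]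
  simp only [h1, sum_add_distrib, h2, h3]
  ring

/-- Replacing the values on `S` by new ones changes the objective only through terms
involving `S`. -/
lemma sonObjective_piecewise_sub [Fintype ι] [DecidableEq ι] (γ : ℝ) (a X Z : ι → E)
    (S : Finset ι) :
    sonObjective γ a (S.piecewise Z X) - sonObjective γ a X =
      (1 / 2) * ∑ i ∈ S, (‖Z i - a i‖ ^ 2 - ‖X i - a i‖ ^ 2)
      + γ / 2 * ∑ i ∈ S, ∑ j ∈ S, (‖Z i - Z j‖ - ‖X i - X j‖)
      + γ * ∑ j ∈ Sᶜ, ∑ i ∈ S, (‖Z i - X j‖ - ‖X i - X j‖) := by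
  have hin : ∀ i ∈ S, S.piecewise Z X i = Z i := fun i hi => piecewise_eq_of_mem _ _ _ hi
  have hout : ∀ i ∈ Sᶜ, S.piecewise Z X i = X i := fun i hi =>
    piecewise_eq_of_notMem _ _ _ (by simpa using hi)
  have q : ∑ i, ‖S.piecewise Z X i - a i‖ ^ 2
      = ∑ i ∈ S, ‖Z i - a i‖ ^ 2 + ∑ i ∈ Sᶜ, ‖X i - a i‖ ^ 2 := by
    rw [← sum_add_sum_compl S]
    congr 1
    · exact sum_congr rfl fun i hi => by rw [hin i hi]
    · exact sum_congr rfl fun i hi => by rw [hout i hi]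
  have r1 : ∑ i ∈ S, ∑ j ∈ S, ‖S.piecewise Z X i - S.piecewise Z X j‖
      = ∑ i ∈ S, ∑ j ∈ S, ‖Z i - Z j‖ :=
    sum_congr rfl fun i hi => sum_congr rfl fun j hj => by rw [hin i hi, hin j hj]
  have r2 : ∑ j ∈ Sᶜ, ∑ i ∈ S, ‖S.piecewise Z X i - S.piecewise Z X j‖
      = ∑ j ∈ Sᶜ, ∑ i ∈ S, ‖Z i - X j‖ :=
    sum_congr rfl fun j hj => sum_congr rfl fun i hi => by rw [hin i hi, hout j hj]
  have r3 : ∑ i ∈ Sᶜ, ∑ j ∈ Sᶜ, ‖S.piecewise Z X i - S.piecewise Z X j‖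
      = ∑ i ∈ Sᶜ, ∑ j ∈ Sᶜ, ‖X i - X j‖ :=
    sum_congr rfl fun i hi => sum_congr rfl fun j hj => by rw [hout i hi, hout j hj]
  have q' := sum_add_sum_compl S fun i => ‖X i - a i‖ ^ 2
  unfold sonObjective
  rw [q, ← q', sum_sum_eq_sum_blocks S _ fun i j => norm_sub_rev _ _,
    sum_sum_eq_sum_blocks S (fun i j => ‖X i - X j‖) fun i j => norm_sub_rev _ _, r1, r2, r3]
  simp only [sum_sub_distrib]
  ring

variable [InnerProductSpace ℝ E]

/-- A sum of inner products is a sum over pairs when the first family sums to zero. -/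
lemma sum_sum_inner_sub_sub (S : Finset ι) (u a : ι → E) (hu : ∑ i ∈ S, u i = 0) :
    ∑ i ∈ S, ∑ j ∈ S, inner ℝ (u i - u j) (a i - a j)
      = 2 * (S.card : ℝ) * ∑ i ∈ S, inner ℝ (u i) (a i) := by
  have h1 : ∑ i ∈ S, ∑ j ∈ S, inner ℝ (u i) (a j) = 0 := by
    simp_rw [← inner_sum]
    rw [← sum_inner, hu, inner_zero_left]
  have h2 : ∑ i ∈ S, ∑ j ∈ S, inner ℝ (u j) (a i) = 0 := by rw [sum_comm, h1]
  simp only [inner_sub_left, inner_sub_right, sum_sub_distrib, h1, h2, sum_const, nsmul_eq_mul,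
    ← mul_sum]
  ring

lemma sum_inner_le_of_norm_sub_le {γ : ℝ} (S : Finset ι) (hS : S.Nonempty) (u a : ι → E)
    (hu : ∑ i ∈ S, u i = 0) (ha : ∀ i ∈ S, ∀ j ∈ S, ‖a i - a j‖ ≤ γ * (S.card : ℝ)) :
    ∑ i ∈ S, inner ℝ (u i) (a i) ≤ γ / 2 * ∑ i ∈ S, ∑ j ∈ S, ‖u i - u j‖ := by
  have hc : (0 : ℝ) < S.card := by exact_mod_cast hS.card_pos
  have h : ∑ i ∈ S, ∑ j ∈ S, inner ℝ (u i - u j) (a i - a j)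
      ≤ ∑ i ∈ S, ∑ j ∈ S, ‖u i - u j‖ * (γ * (S.card : ℝ)) :=
    sum_le_sum fun i hi => sum_le_sum fun j hj => (real_inner_le_norm _ _).trans
      (mul_le_mul_of_nonneg_left (ha i hi j hj) (norm_nonneg _))
  rw [sum_sum_inner_sub_sub S u a hu] at h
  simp_rw [← sum_mul] at h
  refine le_of_mul_le_mul_left ?_ (mul_pos two_pos hc)
  linarith

lemma card_mul_norm_sub_le_sum (S : Finset ι) (X : ι → E) {m : E}
    (hm : ∑ i ∈ S, (X i - m) = 0) (y : E) :
    (S.card : ℝ) * ‖m - y‖ ≤ ∑ i ∈ S, ‖X i - y‖ := by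
  have h : ∑ i ∈ S, (X i - y) = (S.card : ℝ) • (m - y) := by
    have : ∑ i ∈ S, (X i - y) = ∑ i ∈ S, (X i - m) + ∑ i ∈ S, (m - y) := by
      rw [← sum_add_distrib]; simp
    rw [this, hm, sum_const, zero_add, Nat.cast_smul_eq_nsmul]
  calc (S.card : ℝ) * ‖m - y‖ = ‖∑ i ∈ S, (X i - y)‖ := by
        rw [h, norm_smul]; simp
    _ ≤ _ := norm_sum_le _ _

lemma sum_sub_mean_eq_zero (S : Finset ι) (hS : S.Nonempty) (X : ι → E) :
    ∑ i ∈ S, (X i - (S.card : ℝ)⁻¹ • ∑ k ∈ S, X k) = 0 := by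
  have hc : (S.card : ℝ) ≠ 0 := by exact_mod_cast hS.card_pos.ne'
  rw [sum_sub_distrib, sum_const, ← Nat.cast_smul_eq_nsmul ℝ, smul_smul, mul_inv_cancel₀ hc,
    one_smul, sub_self]

/-- A minimizer is constant on every set of data points of diameter at most `γ` times its
cardinality. -/
theorem sonObjective_minimizer_eq_mean [Fintype ι] {γ : ℝ} (hγ : 0 ≤ γ) {a X : ι → E}
    (hmin : ∀ Y, sonObjective γ a X ≤ sonObjective γ a Y) {S : Finset ι}
    (ha : ∀ i ∈ S, ∀ j ∈ S, ‖a i - a j‖ ≤ γ * (S.card : ℝ)) :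
    ∀ i ∈ S, X i = (S.card : ℝ)⁻¹ • ∑ k ∈ S, X k := by
  classical
  intro i₀ hi₀
  have hS : S.Nonempty := ⟨i₀, hi₀⟩
  have hm := sum_sub_mean_eq_zero S hS X
  set m := (S.card : ℝ)⁻¹ • ∑ k ∈ S, X k
  have hdiff := sonObjective_piecewise_sub γ a X (fun _ => m) S
  have hle := hmin (S.piecewise (fun _ => m) X)
  have hquad : ∑ i ∈ S, (‖m - a i‖ ^ 2 - ‖X i - a i‖ ^ 2)
      = 2 * ∑ i ∈ S, inner ℝ (X i - m) (a i) - ∑ i ∈ S, ‖X i - m‖ ^ 2 := by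
    have h0 : ∑ i ∈ S, inner ℝ (X i - m) m = 0 := by rw [← sum_inner, hm, inner_zero_left]
    have : ∀ i, ‖m - a i‖ ^ 2 - ‖X i - a i‖ ^ 2
        = 2 * inner ℝ (X i - m) (a i) - ‖X i - m‖ ^ 2 - 2 * inner ℝ (X i - m) m := by
      intro i
      have e : X i - a i = (X i - m) + (m - a i) := by abel
      rw [e, norm_add_sq_real, inner_sub_right]
      ring
    simp only [this, sum_sub_distrib, ← mul_sum, h0]
    ring
  have hin := sum_inner_le_of_norm_sub_le S hS (fun i => X i - m) a hm ha
  have hcross : ∑ j ∈ Sᶜ, ∑ i ∈ S, (‖m - X j‖ - ‖X i - X j‖) ≤ 0 := by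
    refine sum_nonpos fun j _ => ?_
    have := card_mul_norm_sub_le_sum S X hm (X j)
    rw [sum_sub_distrib, sum_const, nsmul_eq_mul]
    linarith
  have hcross' := mul_nonpos_of_nonneg_of_nonpos hγ hcross
  simp only [sub_sub_sub_cancel_right] at hin
  simp only [sub_self, norm_zero, zero_sub, sum_neg_distrib] at hdiff
  have hsq : ∑ i ∈ S, ‖X i - m‖ ^ 2 ≤ 0 := by
    rw [hquad] at hdiff
    linarith
  have h1 := single_le_sum (f := fun i => ‖X i - m‖ ^ 2) (fun i _ => by positivity) hi₀
  have h2 : ‖X i₀ - m‖ ^ 2 = 0 := le_antisymm (h1.trans hsq) (by positivity)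
  exact sub_eq_zero.mp (norm_eq_zero.mp (pow_eq_zero_iff two_ne_zero |>.mp h2))

/-- Where a minimizer is constant, its value is close to the mean of the data. -/
theorem norm_mean_sub_le_of_minimizer [Fintype ι] {γ : ℝ} (hγ : 0 ≤ γ) {a X : ι → E}
    (hmin : ∀ Y, sonObjective γ a X ≤ sonObjective γ a Y) {S : Finset ι} (hS : S.Nonempty)
    {x : E} (hx : ∀ i ∈ S, X i = x) :
    ‖(S.card : ℝ)⁻¹ • ∑ k ∈ S, a k - x‖ ≤ γ * ((Fintype.card ι : ℝ) - S.card) := by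
  classical
  have hc : (0 : ℝ) < S.card := by exact_mod_cast hS.card_pos
  have hb := sum_sub_mean_eq_zero S hS a
  set b := (S.card : ℝ)⁻¹ • ∑ k ∈ S, a k
  set v := b - x with hv
  set R := γ * ((Fintype.card ι : ℝ) - S.card) with hR
  have hcompl : ((Sᶜ.card : ℕ) : ℝ) = (Fintype.card ι : ℝ) - S.card := by
    rw [card_compl, Nat.cast_sub (card_le_univ S)]
  have hR0 : 0 ≤ R := by rw [hR, ← hcompl]; positivity
  have key : ∀ t : ℝ, 0 < t → (1 - t / 2) * ‖v‖ ^ 2 ≤ R * ‖v‖ := by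
    intro t ht
    have hdiff := sonObjective_piecewise_sub γ a X (fun _ => x + t • v) S
    have hle := hmin (S.piecewise (fun _ => x + t • v) X)
    have hquad : ∑ i ∈ S, (‖x + t • v - a i‖ ^ 2 - ‖X i - a i‖ ^ 2)
        = (S.card : ℝ) * ((t ^ 2 - 2 * t) * ‖v‖ ^ 2) := by
      have h0 : ∑ i ∈ S, inner ℝ (a i - b) v = 0 := by rw [← sum_inner, hb, inner_zero_left]
      have : ∀ i ∈ S, ‖x + t • v - a i‖ ^ 2 - ‖X i - a i‖ ^ 2
          = (t ^ 2 - 2 * t) * ‖v‖ ^ 2 - 2 * t * inner ℝ (a i - b) v := by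
        intro i hi
        have e : x + t • v - a i = (x - a i) + t • v := by abel
        have e' : x - a i = -(a i - b) - v := by rw [hv]; abel
        rw [hx i hi, e, norm_add_sq_real, norm_smul, inner_smul_right, e', inner_sub_left,
          inner_neg_left, real_inner_self_eq_norm_sq, mul_pow, Real.norm_eq_abs, sq_abs]
        ring
      rw [sum_congr rfl this, sum_sub_distrib, sum_const, nsmul_eq_mul, ← mul_sum, h0]
      ring
    have hwithin : ∑ i ∈ S, ∑ j ∈ S, (‖x + t • v - (x + t • v)‖ - ‖X i - X j‖) = 0 :=
      sum_eq_zero fun i hi => sum_eq_zero fun j hj => by simp [hx i hi, hx j hj]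
    have hcross : ∑ j ∈ Sᶜ, ∑ i ∈ S, (‖x + t • v - X j‖ - ‖X i - X j‖)
        ≤ ((Fintype.card ι : ℝ) - S.card) * (S.card * (t * ‖v‖)) := by
      calc _ ≤ ∑ j ∈ Sᶜ, ∑ i ∈ S, t * ‖v‖ := by
            refine sum_le_sum fun j _ => sum_le_sum fun i hi => ?_
            have h := norm_sub_norm_le (x + t • v - X j) (x - X j)
            have e : x + t • v - X j - (x - X j) = t • v := by abel
            rw [e, norm_smul, Real.norm_of_nonneg ht.le] at h
            rwa [hx i hi]
        _ = _ := by rw [sum_const, sum_const, nsmul_eq_mul, nsmul_eq_mul, hcompl]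
    have hcross' := mul_le_mul_of_nonneg_left hcross hγ
    rw [hquad, hwithin] at hdiff
    have : (S.card * t : ℝ) * ((1 - t / 2) * ‖v‖ ^ 2) ≤ (S.card * t : ℝ) * (R * ‖v‖) := by
      rw [hR]
      linarith
    exact le_of_mul_le_mul_left this (by positivity)
  by_contra! hlt
  have hv0 : 0 < ‖v‖ := hR0.trans_lt hlt
  have h := key (1 - R / ‖v‖) (by rw [sub_pos, div_lt_one hv0]; exact hlt)
  have e : (1 - (1 - R / ‖v‖) / 2) * ‖v‖ ^ 2 = (‖v‖ + R) / 2 * ‖v‖ := by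
    field_simp
    ring
  rw [e] at h
  linarith [le_of_mul_le_mul_right h hv0]

/-- Sets of data points with well separated means get different values at a minimizer. -/
theorem sonObjective_minimizer_ne [Fintype ι] {γ : ℝ} (hγ : 0 < γ) {a X : ι → E}
    (hmin : ∀ Y, sonObjective γ a X ≤ sonObjective γ a Y) {S T : Finset ι} (hS : S.Nonempty)
    (hT : T.Nonempty) {x y : E} (hx : ∀ i ∈ S, X i = x) (hy : ∀ i ∈ T, X i = y)
    (hsep : γ * (2 * Fintype.card ι) ≤
      ‖(S.card : ℝ)⁻¹ • ∑ k ∈ S, a k - (T.card : ℝ)⁻¹ • ∑ k ∈ T, a k‖) :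
    x ≠ y := by
  rintro rfl
  have h1 := norm_mean_sub_le_of_minimizer hγ.le hmin hS hx
  have h2 := norm_mean_sub_le_of_minimizer hγ.le hmin hT hy
  have h3 := norm_sub_le_norm_sub_add_norm_sub ((S.card : ℝ)⁻¹ • ∑ k ∈ S, a k) x
    ((T.card : ℝ)⁻¹ • ∑ k ∈ T, a k)
  rw [norm_sub_rev x] at h3
  have hs : 0 < γ * S.card := mul_pos hγ (by exact_mod_cast hS.card_pos)
  have ht : 0 < γ * T.card := mul_pos hγ (by exact_mod_cast hT.card_pos)
  linarith

end

lemma sum_sum_eq_two_mul_sum_lt {ι : Type*} [Fintype ι] [LinearOrder ι] (g : ι → ι → ℝ)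
    (hg : ∀ i j, g i j = g j i) (h0 : ∀ i, g i i = 0) :
    ∑ i, ∑ j, g i j = 2 * ∑ i, ∑ j, if i < j then g i j else 0 := by
  have h1 : ∀ i j, g i j = (if i < j then g i j else 0) + if j < i then g j i else 0 := by
    intro i j
    rcases lt_trichotomy i j with h | rfl | h
    · simp [h, h.not_gt]
    · simp [h0]
    · simp [h, h.not_gt, hg i j]
  have h2 : ∑ i, ∑ j, (if j < i then g j i else 0) = ∑ i, ∑ j, if i < j then g i j else 0 :=
    sum_comm
  rw [sum_congr rfl fun i _ => sum_congr rfl fun j _ => h1 i j]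
  simp only [sum_add_distrib, h2]
  ring



/-- Theorem 1(i) (Panahi et al., as stated in Sun–Toh–Yuan): with uniform weights and
distinct centroids, if `max_α D₂(V_α)/n_α ≤ γ ≤ d₂(C(V))/(2n√K)` (expressed pointwise),
then the unique minimizer of the fully uniformly weighted SON objective (p = 2)
perfectly recovers the partition. -/
theorem panahi_perfect_recovery
    {d n K : ℕ}
    (a : Fin n → Fin d → ℝ)
    (I : Fin K → Finset (Fin n))
    (hdisj : ∀ α β : Fin K, α ≠ β → Disjoint (I α) (I β))
    (hcover : ∀ i : Fin n, ∃ α : Fin K, i ∈ I α)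
    (hne : ∀ α : Fin K, (I α).Nonempty)
    (enorm : (Fin d → ℝ) → ℝ)
    (henorm : ∀ x, enorm x = Real.sqrt (∑ l, (x l)^2))
    (cent : Fin K → Fin d → ℝ)
    (hcent : ∀ α, cent α = (((I α).card : ℝ))⁻¹ • ∑ i ∈ I α, a i)
    (hcentdistinct : ∀ α β, α ≠ β → cent α ≠ cent β)
    (γ : ℝ) (hγ : 0 < γ)
    -- max_α D₂(V_α)/n_α ≤ γ :
    (hγmin : ∀ α : Fin K, ∀ i ∈ I α, ∀ j ∈ I α,
      enorm (a i - a j) ≤ γ * ((I α).card : ℝ))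
    -- γ ≤ d₂(C(V))/(2n√K) :
    (hγmax : ∀ α β : Fin K, α ≠ β →
      γ * (2 * (n : ℝ) * Real.sqrt K) ≤ enorm (cent α - cent β))
    (F : (Fin n → Fin d → ℝ) → ℝ)
    (hF : ∀ X, F X = (1/2) * (∑ i, ∑ l, (X i l - a i l)^2)
        + γ * ∑ i, ∑ j, (if i < j then enorm (X i - X j) else 0))
    (Xstar : Fin n → Fin d → ℝ)
    (hmin : ∀ Y, F Xstar ≤ F Y) :
    ∀ i j : Fin n, Xstar i = Xstar j ↔ ∃ α : Fin K, i ∈ I α ∧ j ∈ I α := by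
  have hnorm : ∀ x : Fin d → ℝ, enorm x = ‖(WithLp.toLp 2 x : EuclideanSpace ℝ (Fin d))‖ := by
    intro x
    simp [henorm, EuclideanSpace.norm_eq]
  have hsub : ∀ x y : Fin d → ℝ, enorm (x - y)
      = ‖(WithLp.toLp 2 x : EuclideanSpace ℝ (Fin d)) - WithLp.toLp 2 y‖ := by
    intro x y
    rw [hnorm, WithLp.toLp_sub]
  let A : Fin n → EuclideanSpace ℝ (Fin d) := fun i => WithLp.toLp 2 (a i)
  let X : Fin n → EuclideanSpace ℝ (Fin d) := fun i => WithLp.toLp 2 (Xstar i)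
  have hFson : ∀ Y : Fin n → Fin d → ℝ,
      F Y = sonObjective γ A fun i => WithLp.toLp 2 (Y i) := by
    intro Y
    have hq : ∀ i, ∑ l, (Y i l - a i l) ^ 2
        = ‖(WithLp.toLp 2 (Y i) : EuclideanSpace ℝ (Fin d)) - A i‖ ^ 2 := by
      intro i
      simp [A, EuclideanSpace.norm_sq_eq]
    rw [hF, sonObjective, sum_sum_eq_two_mul_sum_lt _ (fun i j => norm_sub_rev _ _) (by simp)]
    simp only [hq, hsub]
    ring
  have hXmin : ∀ Y, sonObjective γ A X ≤ sonObjective γ A Y := by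
    intro Y
    have h := hmin fun i => WithLp.ofLp (Y i)
    rwa [hFson, hFson] at h
  have hconst : ∀ α, ∀ i ∈ I α, X i = ((I α).card : ℝ)⁻¹ • ∑ k ∈ I α, X k := fun α =>
    sonObjective_minimizer_eq_mean hγ.le hXmin fun i hi j hj => by
      rw [← hsub]
      exact hγmin α i hi j hj
  have hcentA : ∀ α, WithLp.toLp 2 (cent α) = ((I α).card : ℝ)⁻¹ • ∑ k ∈ I α, A k := by
    intro α
    simp [hcent, A, WithLp.toLp_sum]
  have hXeq : ∀ i j, Xstar i = Xstar j ↔ X i = X j := fun i j =>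
    (WithLp.toLp_injective 2).eq_iff.symm
  intro i j
  rw [hXeq]
  constructor
  · intro hij
    obtain ⟨α, hi⟩ := hcover i
    obtain ⟨β, hj⟩ := hcover j
    by_cases hαβ : α = β
    · exact ⟨α, hi, hαβ ▸ hj⟩
    refine absurd hij ?_
    rw [hconst α i hi, hconst β j hj]
    refine sonObjective_minimizer_ne hγ hXmin (hne α) (hne β) (hconst α) (hconst β) ?_
    rw [← hcentA, ← hcentA, ← hsub, Fintype.card_fin]
    refine le_trans ?_ (hγmax α β hαβ)
    have hK : (1 : ℝ) ≤ Real.sqrt K :=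
      Real.one_le_sqrt.mpr (by exact_mod_cast α.pos)
    exact mul_le_mul_of_nonneg_left (le_mul_of_one_le_right (by positivity) hK) hγ.le
  · rintro ⟨α, hi, hj⟩
    rw [hconst α i hi, hconst α j hj]
end
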